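/- With H, L1, L2 the E1 system symmetries (H = p1^2+p2^2+a1(x^2+y^2)+a2/x^2+a3/y^2, L1 = (x p2 - y p1)^2 + a2 y^2/x^2 + a3 x^2/y^2, L2 = p1^2 + a1 x^2 + a2/x^2) and R = {L1, L2}, the Casimir identity R^2 = 16*( L1*L2*H - L1*L2^2 - (a2 + a3)*L2^2 - a2*H^2 + 2*a2*L2*H - a1*L1^2 + 4*a1*a2*a3 ) holds identically on x ≠ 0, y ≠ 0. -/

import Mathlib

/-- Canonical Poisson bracket on phase space (x, y, p1, p2). -/
noncomputable def poissonBracket (F G : ℝ → ℝ → ℝ → ℝ → ℝ) (x y p1 p2 : ℝ) : ℝ :=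
    deriv (fun t => F x y t p2) p1 * deriv (fun t => G t y p1 p2) x
  + deriv (fun t => F x y p1 t) p2 * deriv (fun t => G x t p1 p2) y
  - deriv (fun t => G x y t p2) p1 * deriv (fun t => F t y p1 p2) x
  - deriv (fun t => G x y p1 t) p2 * deriv (fun t => F x t p1 p2) y

noncomputable def Hf (a1 a2 a3 : ℝ) : ℝ → ℝ → ℝ → ℝ → ℝ :=
  fun x y p1 p2 => p1^2 + p2^2 + a1*(x^2 + y^2) + a2/x^2 + a3/y^2
noncomputable def L1f (a2 a3 : ℝ) : ℝ → ℝ → ℝ → ℝ → ℝ :=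
  fun x y p1 p2 => (x*p2 - y*p1)^2 + a2*y^2/x^2 + a3*x^2/y^2
noncomputable def L2f (a1 a2 : ℝ) : ℝ → ℝ → ℝ → ℝ → ℝ :=
  fun x _ p1 _ => p1^2 + a1*x^2 + a2/x^2

theorem hasDerivAt_const_div_sq (a : ℝ) {x : ℝ} (hx : x ≠ 0) :
    HasDerivAt (fun t : ℝ => a / t ^ 2) (-2 * a / x ^ 3) x := by
  refine ((hasDerivAt_const x a).fun_div (hasDerivAt_pow 2 x)
    (pow_ne_zero 2 hx)).congr_deriv ?_
  simp
  field_simp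

theorem deriv_L1f_p1 (a2 a3 x y p1 p2 : ℝ) :
    deriv (fun t => L1f a2 a3 x y t p2) p1 = -2 * y * (x * p2 - y * p1) := by
  have h := (((((hasDerivAt_id p1).const_mul y).const_sub (x * p2)).fun_pow 2).add_const
    (a2 * y ^ 2 / x ^ 2)).add_const (a3 * x ^ 2 / y ^ 2)
  refine h.deriv.trans ?_
  simp
  ring

theorem deriv_L1f_x (a2 a3 : ℝ) {x : ℝ} (y p1 p2 : ℝ) (hx : x ≠ 0) :
    deriv (fun t => L1f a2 a3 t y p1 p2) x =
      2 * p2 * (x * p2 - y * p1) - 2 * a2 * y ^ 2 / x ^ 3 + 2 * a3 * x / y ^ 2 := by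
  have h := (((((hasDerivAt_id x).mul_const p2).sub_const (y * p1)).fun_pow 2).fun_add
    (hasDerivAt_const_div_sq (a2 * y ^ 2) hx)).fun_add
    (((hasDerivAt_pow 2 x).const_mul a3).div_const (y ^ 2))
  refine h.deriv.trans ?_
  simp
  ring

theorem deriv_L2f_p1 (a1 a2 x y p1 p2 : ℝ) :
    deriv (fun t => L2f a1 a2 x y t p2) p1 = 2 * p1 := by
  have h := ((hasDerivAt_pow 2 p1).add_const (a1 * x ^ 2)).add_const (a2 / x ^ 2)
  refine h.deriv.trans ?_
  simp

theorem deriv_L2f_x (a1 a2 : ℝ) {x : ℝ} (y p1 p2 : ℝ) (hx : x ≠ 0) :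
    deriv (fun t => L2f a1 a2 t y p1 p2) x = 2 * a1 * x - 2 * a2 / x ^ 3 := by
  have h := (((hasDerivAt_pow 2 x).const_mul a1).const_add (p1 ^ 2)).fun_add
    (hasDerivAt_const_div_sq a2 hx)
  refine h.deriv.trans ?_
  simp
  ring

/-- `L2f` depends only on `x` and `p1`, so only the first conjugate pair contributes. -/
theorem poissonBracket_L1f_L2f (a1 a2 a3 : ℝ) {x : ℝ} (y p1 p2 : ℝ) (hx : x ≠ 0) :
    poissonBracket (L1f a2 a3) (L2f a1 a2) x y p1 p2 =
      -2 * y * (x * p2 - y * p1) * (2 * a1 * x - 2 * a2 / x ^ 3)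
        - 2 * p1 * (2 * p2 * (x * p2 - y * p1) - 2 * a2 * y ^ 2 / x ^ 3
          + 2 * a3 * x / y ^ 2) := by
  have hy : deriv (fun t => L2f a1 a2 x t p1 p2) y = 0 := deriv_const _ _
  have hp : deriv (fun t => L2f a1 a2 x y p1 t) p2 = 0 := deriv_const _ _
  rw [poissonBracket, deriv_L1f_p1, deriv_L1f_x a2 a3 y p1 p2 hx, deriv_L2f_p1,
    deriv_L2f_x a1 a2 y p1 p2 hx, hy, hp]
  ring

theorem E1_casimir (a1 a2 a3 : ℝ) (x y p1 p2 : ℝ)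
    (hx : x ≠ 0) (hy : y ≠ 0) :
    (poissonBracket (L1f a2 a3) (L2f a1 a2) x y p1 p2)^2 =
      16 * ( L1f a2 a3 x y p1 p2 * L2f a1 a2 x y p1 p2 * Hf a1 a2 a3 x y p1 p2
        - L1f a2 a3 x y p1 p2 * (L2f a1 a2 x y p1 p2)^2
        - (a2 + a3) * (L2f a1 a2 x y p1 p2)^2
        - a2 * (Hf a1 a2 a3 x y p1 p2)^2
        + 2 * a2 * L2f a1 a2 x y p1 p2 * Hf a1 a2 a3 x y p1 p2
        - a1 * (L1f a2 a3 x y p1 p2)^2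
        + 4 * a1 * a2 * a3 ) := by
  rw [poissonBracket_L1f_L2f a1 a2 a3 y p1 p2 hx]
  simp only [L1f, L2f, Hf]
  field_simp
  ring
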